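/- arXiv:1904.06628 — 11 statements merged into one kernel-verified Lean document; each statement's English description precedes it below -/
import Mathlib

section
/- If r ≤ r_L ≤ μ - σ², then b̄ := (μ - r_L)/σ² maximizes Γ(b, r_L) over the set {b ∈ ℝ : b ≥ 1}, the corresponding margin-loan quantity is q̄ = (μ - r_L)/σ² - 1 ≥ 0, the broker's profit rate is π(b̄, r_L) = ((μ - r_L)/σ² - 1)(r_L - r), and the gambler's growth rate is Γ(b̄, r_L) = r_L + (1/2)((μ - r_L)/σ)². -/
/-- The gambler's asymptotic growth rate `Γ(b, r_L) = r_L + b(μ - r_L) - (σ²/2)b²`. -/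
noncomputable def growthRate (μ σ : ℝ) (b rL : ℝ) : ℝ :=
  rL + b * (μ - rL) - σ ^ 2 / 2 * b ^ 2

/-- The broker's profit rate `π(b, r_L) = (b - 1)(r_L - r)`. -/
noncomputable def profitRate (r : ℝ) (b rL : ℝ) : ℝ :=
  (b - 1) * (rL - r)

/-- Completing the square: the growth rate is a downward parabola with vertex `(μ - r_L)/σ²`. -/
theorem growthRate_eq_sub_sq {σ : ℝ} (hσ : σ ≠ 0) (μ b rL : ℝ) :
    growthRate μ σ b rL =
      rL + (1 / 2) * ((μ - rL) / σ) ^ 2 - σ ^ 2 / 2 * (b - (μ - rL) / σ ^ 2) ^ 2 := by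
  unfold growthRate
  field_simp
  ring

/-- If `r ≤ r_L ≤ μ - σ²`, then `b̄ := (μ - r_L)/σ²` maximizes `Γ(·, r_L)` over `{b : b ≥ 1}`,
the margin-loan quantity `q̄ = (μ - r_L)/σ² - 1` is nonnegative, the broker's profit rate is
`((μ - r_L)/σ² - 1)(r_L - r)`, and the gambler's growth rate is `r_L + (1/2)((μ - r_L)/σ)²`. -/
theorem stmt1 (μ σ r : ℝ) (hσ : 0 < σ) (rL : ℝ) (h1 : r ≤ rL) (h2 : rL ≤ μ - σ ^ 2) :
    (∀ b : ℝ, 1 ≤ b → growthRate μ σ b rL ≤ growthRate μ σ ((μ - rL) / σ ^ 2) rL) ∧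
    (0 ≤ (μ - rL) / σ ^ 2 - 1) ∧
    profitRate r ((μ - rL) / σ ^ 2) rL = ((μ - rL) / σ ^ 2 - 1) * (rL - r) ∧
    growthRate μ σ ((μ - rL) / σ ^ 2) rL = rL + (1 / 2) * ((μ - rL) / σ) ^ 2 := by
  have hmax : growthRate μ σ ((μ - rL) / σ ^ 2) rL = rL + (1 / 2) * ((μ - rL) / σ) ^ 2 := by
    simp [growthRate_eq_sub_sq hσ.ne']
  refine ⟨fun b _ => ?_, ?_, rfl, hmax⟩
  · rw [hmax, growthRate_eq_sub_sq hσ.ne']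
    exact sub_le_self _ (by positivity)
  · rw [sub_nonneg, one_le_div (by positivity)]
    linarith
end

section
/- Suppose (b*, r_L*) is a local maximum of the Nash product N(b, r_L) with b* > 1 and π(b*, r_L*) > π̄. Then the egalitarian condition Γ(b*, r_L*) - Γ̄ = π(b*, r_L*) - π̄ holds, i.e. the growth-rate surplus gained by the gambler equals the profit-rate surplus gained by the broker. -/
/-- The Nash product `N(b, r_L) = (π(b, r_L) - π̄)(Γ(b, r_L) - Γ̄)`. -/
noncomputable def nashProduct (μ σ r πbar Γbar : ℝ) (b rL : ℝ) : ℝ :=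
  (profitRate r b rL - πbar) * (growthRate μ σ b rL - Γbar)

theorem hasDerivAt_nashProduct_rate (μ σ r πbar Γbar b x : ℝ) :
    HasDerivAt (fun y => nashProduct μ σ r πbar Γbar b y)
      ((b - 1) * ((growthRate μ σ b x - Γbar) - (profitRate r b x - πbar))) x := by
  have hprofit : HasDerivAt (fun y => profitRate r b y) (b - 1) x := by
    simpa [profitRate] using ((hasDerivAt_id x).sub_const r).const_mul (b - 1)
  have hgrowth : HasDerivAt (fun y => growthRate μ σ b y) (1 - b) x := by
    simpa [growthRate, sub_eq_add_neg] using
      ((hasDerivAt_id x).add (((hasDerivAt_id x).const_sub μ).const_mul b)).sub_const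
        (σ ^ 2 / 2 * b ^ 2)
  refine ((hprofit.sub_const πbar).mul (hgrowth.sub_const Γbar)).congr_deriv ?_
  ring

/-- If `(b*, r_L*)` is a local maximum of the Nash product with `b* > 1` and
`π(b*, r_L*) > π̄`, then the egalitarian condition `Γ(b*, r_L*) - Γ̄ = π(b*, r_L*) - π̄`
holds. -/
theorem stmt2 (μ σ r πbar Γbar : ℝ) (hσ : 0 < σ) (bstar rLstar : ℝ)
    (hmax : IsLocalMax (fun p : ℝ × ℝ => nashProduct μ σ r πbar Γbar p.1 p.2) (bstar, rLstar))
    (hb : 1 < bstar) (hπ : πbar < profitRate r bstar rLstar) :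
    growthRate μ σ bstar rLstar - Γbar = profitRate r bstar rLstar - πbar := by
  have hslice : IsLocalMax (fun y => nashProduct μ σ r πbar Γbar bstar y) rLstar :=
    hmax.comp_continuous (g := fun y => (bstar, y)) (b := rLstar) (by fun_prop)
  have hzero := hslice.hasDerivAt_eq_zero (hasDerivAt_nashProduct_rate μ σ r πbar Γbar bstar rLstar)
  exact sub_eq_zero.mp ((mul_eq_zero.mp hzero).resolve_left (sub_pos.mpr hb).ne')
end

section
/- Suppose (b*, r_L*) is a local maximum of the Nash product N(b, r_L) with b* > 1, π(b*, r_L*) > π̄, and Γ(b*, r_L*) > Γ̄. Then b* = (μ - r)/σ²: regardless of the threat point (π̄, Γ̄), the gambler negotiates to bet as if he himself could borrow at the broker's call rate r. -/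
theorem hasDerivAt_nashProduct_left (μ σ r πbar Γbar b rL : ℝ) :
    HasDerivAt (fun b => nashProduct μ σ r πbar Γbar b rL)
      ((rL - r) * (growthRate μ σ b rL - Γbar) +
        (profitRate r b rL - πbar) * (μ - rL - σ ^ 2 * b)) b := by
  have hP : HasDerivAt (fun b => profitRate r b rL - πbar) (1 * (rL - r)) b :=
    (((hasDerivAt_id b).sub_const 1).mul_const (rL - r)).sub_const πbar
  have hG : HasDerivAt (fun b => growthRate μ σ b rL - Γbar)
      (1 * (μ - rL) - σ ^ 2 / 2 * (2 * b)) b := by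
    have hsq : HasDerivAt (fun b : ℝ => b ^ 2) (2 * b) b := by simpa using hasDerivAt_pow 2 b
    exact ((((hasDerivAt_id b).mul_const (μ - rL)).const_add rL).sub
      (hsq.const_mul (σ ^ 2 / 2))).sub_const Γbar
  exact (hP.mul hG).congr_deriv (by ring)

theorem hasDerivAt_nashProduct_right (μ σ r πbar Γbar b rL : ℝ) :
    HasDerivAt (fun rL => nashProduct μ σ r πbar Γbar b rL)
      ((b - 1) * ((growthRate μ σ b rL - Γbar) - (profitRate r b rL - πbar))) rL := by
  have hP : HasDerivAt (fun rL => profitRate r b rL - πbar) ((b - 1) * 1) rL :=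
    (((hasDerivAt_id rL).sub_const r).const_mul (b - 1)).sub_const πbar
  have hG : HasDerivAt (fun rL => growthRate μ σ b rL - Γbar) (1 + b * -1) rL :=
    (((hasDerivAt_id rL).add (((hasDerivAt_id rL).const_sub μ).const_mul b)).sub_const
      (σ ^ 2 / 2 * b ^ 2)).sub_const Γbar
  exact (hP.mul hG).congr_deriv (by ring)

/-- If `(b*, r_L*)` is a local maximum of the Nash product with `b* > 1`,
`π(b*, r_L*) > π̄`, and `Γ(b*, r_L*) > Γ̄`, then `b* = (μ - r)/σ²`: regardless of the
threat point, the gambler negotiates to bet as if he could borrow at the call rate `r`. -/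
theorem stmt3 (μ σ r πbar Γbar : ℝ) (hσ : 0 < σ) (bstar rLstar : ℝ)
    (hmax : IsLocalMax (fun p : ℝ × ℝ => nashProduct μ σ r πbar Γbar p.1 p.2) (bstar, rLstar))
    (hb : 1 < bstar) (hπ : πbar < profitRate r bstar rLstar)
    (hΓ : Γbar < growthRate μ σ bstar rLstar) :
    bstar = (μ - r) / σ ^ 2 := by
  have hmax_left : IsLocalMax (fun b => nashProduct μ σ r πbar Γbar b rLstar) bstar :=
    hmax.comp_continuous (g := fun b => (b, rLstar)) (b := bstar) (by fun_prop)
  have hmax_right : IsLocalMax (fun rL => nashProduct μ σ r πbar Γbar bstar rL) rLstar :=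
    hmax.comp_continuous (g := fun rL => (bstar, rL)) (b := rLstar) (by fun_prop)
  have hleft := hmax_left.hasDerivAt_eq_zero
    (hasDerivAt_nashProduct_left μ σ r πbar Γbar bstar rLstar)
  have hright := hmax_right.hasDerivAt_eq_zero
    (hasDerivAt_nashProduct_right μ σ r πbar Γbar bstar rLstar)
  have hsurplus : growthRate μ σ bstar rLstar - Γbar = profitRate r bstar rLstar - πbar :=
    sub_eq_zero.1 ((mul_eq_zero.1 hright).resolve_left (sub_pos.2 hb).ne')
  rw [hsurplus] at hleft
  have hfoc : (profitRate r bstar rLstar - πbar) * (μ - r - σ ^ 2 * bstar) = 0 := by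
    linear_combination hleft
  have hbet := (mul_eq_zero.1 hfoc).resolve_left (sub_pos.2 hπ).ne'
  rw [eq_div_iff (pow_pos hσ 2).ne']
  linear_combination -hbet
end

section
/- For all b ∈ ℝ and r_L ∈ ℝ, the identity Γ(b, r_L) + π(b, r_L) = r + b(μ - r) - (σ²/2)b² holds; consequently Γ(b, r_L) + π(b, r_L) ≤ r + (1/2)((μ - r)/σ)², with equality if and only if b = (μ - r)/σ². In particular the efficient profit–growth frontier is the straight line Γ = r + (1/2)((μ - r)/σ)² - π of slope -1, so the bargaining problem has transferable utility. -/
/-- The joint surplus does not depend on the margin rate. -/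
theorem growthRate_add_profitRate (μ σ r b rL : ℝ) :
    growthRate μ σ b rL + profitRate r b rL = r + b * (μ - r) - σ ^ 2 / 2 * b ^ 2 := by
  unfold growthRate profitRate
  ring

/-- Completing the square in the bet fraction. -/
theorem growthRate_add_profitRate_eq_sub_sq (μ r b rL : ℝ) {σ : ℝ} (hσ : σ ≠ 0) :
    growthRate μ σ b rL + profitRate r b rL =
      r + (1 / 2) * ((μ - r) / σ) ^ 2 - σ ^ 2 / 2 * (b - (μ - r) / σ ^ 2) ^ 2 := by
  rw [growthRate_add_profitRate]
  field_simp
  ring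

/-- For all `b` and `r_L`: the identity `Γ + π = r + b(μ - r) - (σ²/2)b²` holds; hence
`Γ + π ≤ r + (1/2)((μ - r)/σ)²`, with equality iff `b = (μ - r)/σ²`.  In particular the
efficient profit–growth frontier is the straight line `Γ = r + (1/2)((μ - r)/σ)² - π`
of slope `-1`, so the bargaining problem has transferable utility. -/
theorem stmt6 (μ σ r : ℝ) (hσ : 0 < σ) :
    ∀ b rL : ℝ,
      growthRate μ σ b rL + profitRate r b rL = r + b * (μ - r) - σ ^ 2 / 2 * b ^ 2 ∧
      growthRate μ σ b rL + profitRate r b rL ≤ r + (1 / 2) * ((μ - r) / σ) ^ 2 ∧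
      (growthRate μ σ b rL + profitRate r b rL = r + (1 / 2) * ((μ - r) / σ) ^ 2 ↔
        b = (μ - r) / σ ^ 2) := by
  intro b rL
  refine ⟨growthRate_add_profitRate μ σ r b rL, ?_, ?_⟩
  · rw [growthRate_add_profitRate_eq_sub_sq μ r b rL hσ.ne']
    exact sub_le_self _ (by positivity)
  · rw [growthRate_add_profitRate_eq_sub_sq μ r b rL hσ.ne', sub_eq_self]
    simp [hσ.ne', sub_eq_zero]
end

section
/- Suppose (b*, r_L*) is a local maximum of the Nash product N(b, r_L) with b* > 1, π(b*, r_L*) > π̄, and Γ(b*, r_L*) > Γ̄. Then the final utilities are π(b*, r_L*) = (r - (Γ̄ - π̄))/2 + (1/4)((μ - r)/σ)² and Γ(b*, r_L*) = (r + (Γ̄ - π̄))/2 + (1/4)((μ - r)/σ)². -/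
theorem hasDerivAt_profitRate_rate (r b x : ℝ) :
    HasDerivAt (fun y => profitRate r b y) (b - 1) x := by
  simpa [profitRate] using ((hasDerivAt_id x).sub_const r).const_mul (b - 1)

theorem hasDerivAt_profitRate_bet (r b x : ℝ) :
    HasDerivAt (fun y => profitRate r y x) (x - r) b := by
  simpa [profitRate] using ((hasDerivAt_id b).sub_const 1).mul_const (x - r)

theorem hasDerivAt_growthRate_rate (μ σ b x : ℝ) :
    HasDerivAt (fun y => growthRate μ σ b y) (1 - b) x := by
  have h := ((hasDerivAt_id' x).add (((hasDerivAt_id' x).const_sub μ).const_mul b)).sub_const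
    (σ ^ 2 / 2 * b ^ 2)
  exact h.congr_deriv (by ring)

theorem hasDerivAt_growthRate_bet (μ σ b x : ℝ) :
    HasDerivAt (fun y => growthRate μ σ y x) (μ - x - σ ^ 2 * b) b := by
  have h := (((hasDerivAt_id' b).mul_const (μ - x)).const_add x).sub
    (((hasDerivAt_id' b).pow 2).const_mul (σ ^ 2 / 2))
  exact h.congr_deriv (by push_cast; ring)

/-- If `(b*, r_L*)` is a local maximum of the Nash product with `b* > 1`,
`π(b*, r_L*) > π̄`, and `Γ(b*, r_L*) > Γ̄`, then the final utilities are
`π* = (r - (Γ̄ - π̄))/2 + (1/4)((μ - r)/σ)²` and `Γ* = (r + (Γ̄ - π̄))/2 + (1/4)((μ - r)/σ)²`. -/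
theorem stmt7 (μ σ r πbar Γbar : ℝ) (hσ : 0 < σ) (bstar rLstar : ℝ)
    (hmax : IsLocalMax (fun p : ℝ × ℝ => nashProduct μ σ r πbar Γbar p.1 p.2) (bstar, rLstar))
    (hb : 1 < bstar) (hπ : πbar < profitRate r bstar rLstar)
    (hΓ : Γbar < growthRate μ σ bstar rLstar) :
    profitRate r bstar rLstar = (r - (Γbar - πbar)) / 2 + (1 / 4) * ((μ - r) / σ) ^ 2 ∧
    growthRate μ σ bstar rLstar = (r + (Γbar - πbar)) / 2 + (1 / 4) * ((μ - r) / σ) ^ 2 := by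
  have hrate : IsLocalMax (fun y => nashProduct μ σ r πbar Γbar bstar y) rLstar :=
    hmax.comp_tendsto (g := fun y => (bstar, y))
      (Continuous.prodMk_right bstar).continuousAt
  have hbet : IsLocalMax (fun y => nashProduct μ σ r πbar Γbar y rLstar) bstar :=
    hmax.comp_tendsto (g := fun y => (y, rLstar))
      (Continuous.prodMk_left rLstar).continuousAt
  have foc_rate := hrate.hasDerivAt_eq_zero
    (((hasDerivAt_profitRate_rate r bstar rLstar).sub_const πbar).mul
      ((hasDerivAt_growthRate_rate μ σ bstar rLstar).sub_const Γbar))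
  have foc_bet := hbet.hasDerivAt_eq_zero
    (((hasDerivAt_profitRate_bet r bstar rLstar).sub_const πbar).mul
      ((hasDerivAt_growthRate_bet μ σ bstar rLstar).sub_const Γbar))
  have surplus_eq :
      growthRate μ σ bstar rLstar - Γbar = profitRate r bstar rLstar - πbar := by
    apply mul_left_cancel₀ (sub_ne_zero.mpr hb.ne')
    linear_combination foc_rate
  have bet_eq : bstar = (μ - r) / σ ^ 2 := by
    rw [surplus_eq] at foc_bet
    have h : μ - r - σ ^ 2 * bstar = 0 := by
      apply (mul_eq_zero.mp _).resolve_left (sub_ne_zero.mpr hπ.ne')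
      linear_combination foc_bet
    rw [eq_div_iff (by positivity)]
    linear_combination -h
  have total_eq : profitRate r bstar rLstar + growthRate μ σ bstar rLstar =
      r + (1 / 2) * ((μ - r) / σ) ^ 2 := by
    calc profitRate r bstar rLstar + growthRate μ σ bstar rLstar
        = r + bstar * (μ - r) - σ ^ 2 / 2 * bstar ^ 2 := by
          simp only [profitRate, growthRate]
          ring
      _ = r + (1 / 2) * ((μ - r) / σ) ^ 2 := by
          rw [bet_eq]
          field_simp
          ring
  constructor <;> linarith
end

section
/- Suppose (b*, r_L*) is a local maximum of the Nash product N(b, r_L) with 𝟏ᵀb* > 1, π(b*, r_L*) > π̄, and Γ(b*, r_L*) > Γ̄. Then b* = Σ⁻¹(μ - r·𝟏) — the continuous-time Kelly portfolio of a gambler permitted to borrow at the broker's call rate r — and the egalitarian condition Γ(b*, r_L*) - Γ̄ = π(b*, r_L*) - π̄ holds. -/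
open Matrix

/-- The gambler's asymptotic growth rate `Γ(b, r_L) = r_L + (μ - r_L·𝟏)ᵀb - (1/2)bᵀΣb`. -/
noncomputable def growthRateV {n : ℕ} (μ : Fin n → ℝ) (S : Matrix (Fin n) (Fin n) ℝ)
    (b : Fin n → ℝ) (rL : ℝ) : ℝ :=
  rL + (μ - rL • (1 : Fin n → ℝ)) ⬝ᵥ b - (1 / 2) * (b ⬝ᵥ (S *ᵥ b))

/-- The broker's profit rate `π(b, r_L) = (𝟏ᵀb - 1)(r_L - r)`. -/
noncomputable def profitRateV {n : ℕ} (r : ℝ) (b : Fin n → ℝ) (rL : ℝ) : ℝ :=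
  ((1 : Fin n → ℝ) ⬝ᵥ b - 1) * (rL - r)

/-- The Nash product `N(b, r_L) = (π(b, r_L) - π̄)(Γ(b, r_L) - Γ̄)`. -/
noncomputable def nashProductV {n : ℕ} (μ : Fin n → ℝ) (S : Matrix (Fin n) (Fin n) ℝ)
    (r πbar Γbar : ℝ) (b : Fin n → ℝ) (rL : ℝ) : ℝ :=
  (profitRateV r b rL - πbar) * (growthRateV μ S b rL - Γbar)

/-- First-order condition for a local maximum of the product of an affine and a quadratic function
along a continuous curve. -/
theorem IsLocalMax.affine_mul_quadratic_eq_zero {E : Type*} [TopologicalSpace E] {f : E → ℝ}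
    {x : E} (hf : IsLocalMax f x) {γ : ℝ → E} (hγ : Continuous γ) (hx : γ 0 = x)
    {P a G c d : ℝ} (h : ∀ t, f (γ t) = (P + t * a) * (G + t * c + t ^ 2 * d)) :
    P * c + a * G = 0 := by
  subst hx
  have hloc : IsLocalMax (f ∘ γ) 0 := hf.comp_continuous hγ.continuousAt
  have hcomp : f ∘ γ = fun t => (P + t * a) * (G + t * c + t ^ 2 * d) := funext h
  rw [hcomp] at hloc
  have hP : HasDerivAt (fun t : ℝ => P + t * a) a 0 := by
    simpa using ((hasDerivAt_id (0 : ℝ)).mul_const a).const_add P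
  have hG : HasDerivAt (fun t : ℝ => G + t * c + t ^ 2 * d) c 0 := by
    simpa using (((hasDerivAt_id' (0 : ℝ)).mul_const c).const_add G).fun_add
      ((hasDerivAt_pow 2 (0 : ℝ)).mul_const d)
  have hderiv := hloc.hasDerivAt_eq_zero (hP.mul hG)
  simp only [zero_mul, add_zero, ne_eq, OfNat.ofNat_ne_zero, not_false_eq_true, zero_pow]
    at hderiv
  linarith

/-- The growth rate along a change of the margin rate. -/
theorem growthRateV_add_rate {n : ℕ} (μ : Fin n → ℝ) (S : Matrix (Fin n) (Fin n) ℝ)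
    (b : Fin n → ℝ) (rL t : ℝ) :
    growthRateV μ S b (rL + t) =
      growthRateV μ S b rL - t * ((1 : Fin n → ℝ) ⬝ᵥ b - 1) := by
  simp only [growthRateV, sub_dotProduct, smul_dotProduct, smul_eq_mul]
  ring

/-- The growth rate along a change of the portfolio. -/
theorem growthRateV_add_smul {n : ℕ} (μ : Fin n → ℝ) {S : Matrix (Fin n) (Fin n) ℝ}
    (hS : S.IsSymm) (b v : Fin n → ℝ) (rL t : ℝ) :
    growthRateV μ S (b + t • v) rL = growthRateV μ S b rL
      + t * ((μ - rL • (1 : Fin n → ℝ) - S *ᵥ b) ⬝ᵥ v) + t ^ 2 * (-(1 / 2) * (v ⬝ᵥ (S *ᵥ v))) := by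
  have hsymm : b ⬝ᵥ (S *ᵥ v) = (S *ᵥ b) ⬝ᵥ v := by
    rw [dotProduct_mulVec, ← mulVec_transpose, hS.eq]
  have hcomm : v ⬝ᵥ (S *ᵥ b) = (S *ᵥ b) ⬝ᵥ v := dotProduct_comm _ _
  simp only [growthRateV, mulVec_add, mulVec_smul, add_dotProduct, dotProduct_add, sub_dotProduct,
    smul_dotProduct, dotProduct_smul, smul_eq_mul, hsymm, hcomm]
  ring

/-- If `(b*, r_L*)` is a local maximum of the Nash product with `𝟏ᵀb* > 1`,
`π(b*, r_L*) > π̄`, and `Γ(b*, r_L*) > Γ̄`, then `b* = Σ⁻¹(μ - r·𝟏)` — the continuous-time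
Kelly portfolio of a gambler permitted to borrow at the broker's call rate `r` — and the
egalitarian condition `Γ(b*, r_L*) - Γ̄ = π(b*, r_L*) - π̄` holds. -/
theorem stmt11 {n : ℕ} (hn : 1 ≤ n) (μ : Fin n → ℝ) (S : Matrix (Fin n) (Fin n) ℝ)
    (hS : S.PosDef) (r πbar Γbar : ℝ) (bstar : Fin n → ℝ) (rLstar : ℝ)
    (hmax : IsLocalMax (fun p : (Fin n → ℝ) × ℝ =>
      nashProductV μ S r πbar Γbar p.1 p.2) (bstar, rLstar))
    (hb : 1 < (1 : Fin n → ℝ) ⬝ᵥ bstar)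
    (hπ : πbar < profitRateV r bstar rLstar)
    (hΓ : Γbar < growthRateV μ S bstar rLstar) :
    bstar = S⁻¹ *ᵥ (μ - r • (1 : Fin n → ℝ)) ∧
    growthRateV μ S bstar rLstar - Γbar = profitRateV r bstar rLstar - πbar := by
  have hegal : growthRateV μ S bstar rLstar - Γbar = profitRateV r bstar rLstar - πbar := by
    have hrate := hmax.affine_mul_quadratic_eq_zero (γ := fun t : ℝ => (bstar, rLstar + t))
      (by fun_prop) (by simp) (P := profitRateV r bstar rLstar - πbar)
      (a := (1 : Fin n → ℝ) ⬝ᵥ bstar - 1) (G := growthRateV μ S bstar rLstar - Γbar)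
      (c := -((1 : Fin n → ℝ) ⬝ᵥ bstar - 1)) (d := 0) (by
        intro t
        simp only [nashProductV, growthRateV_add_rate, profitRateV]
        ring)
    have hne : (1 : Fin n → ℝ) ⬝ᵥ bstar - 1 ≠ 0 := (sub_pos.mpr hb).ne'
    apply mul_left_cancel₀ hne
    linarith
  refine ⟨?_, hegal⟩
  have hsymm : S.IsSymm := by
    simpa [Matrix.IsHermitian, Matrix.IsSymm, conjTranspose_eq_transpose_of_trivial] using hS.isHermitian
  have hfoc : ∀ v : Fin n → ℝ, (μ - r • (1 : Fin n → ℝ) - S *ᵥ bstar) ⬝ᵥ v = 0 := by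
    intro v
    have hport := hmax.affine_mul_quadratic_eq_zero (γ := fun t : ℝ => (bstar + t • v, rLstar))
      (by fun_prop) (by simp) (P := profitRateV r bstar rLstar - πbar)
      (a := ((1 : Fin n → ℝ) ⬝ᵥ v) * (rLstar - r)) (G := growthRateV μ S bstar rLstar - Γbar)
      (c := (μ - rLstar • (1 : Fin n → ℝ) - S *ᵥ bstar) ⬝ᵥ v)
      (d := -(1 / 2) * (v ⬝ᵥ (S *ᵥ v))) (by
        intro t
        simp only [nashProductV, growthRateV_add_smul μ hsymm, profitRateV, dotProduct_add,
          dotProduct_smul, smul_eq_mul]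
        ring)
    rw [hegal] at hport
    apply mul_left_cancel₀ (sub_pos.mpr hπ).ne'
    simp only [sub_dotProduct, smul_dotProduct, smul_eq_mul] at hport ⊢
    linear_combination hport
  have hkelly : μ - r • (1 : Fin n → ℝ) = S *ᵥ bstar :=
    sub_eq_zero.mp (dotProduct_self_eq_zero.mp (hfoc _))
  rw [hkelly, mulVec_mulVec, nonsing_inv_mul _ ((isUnit_iff_isUnit_det S).mp hS.isUnit),
    one_mulVec]
end

section
/- Assume 𝟏ᵀΣ⁻¹(μ - r·𝟏) > 1. Suppose (b*, r_L*) is a local maximum of the Nash product N(b, r_L) with 𝟏ᵀb* > 1, π(b*, r_L*) > π̄, and Γ(b*, r_L*) > Γ̄. Then the negotiated interest rate satisfies r_L* = r/2 + (μᵀΣ⁻¹μ - r²·𝟏ᵀΣ⁻¹𝟏 - 2(Γ̄ - π̄)) / (4(𝟏ᵀΣ⁻¹(μ - r·𝟏) - 1)). -/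
open Matrix

/-- First-order condition for a product of an affine and a quadratic function of one variable. -/
theorem IsLocalMax.affine_mul_quadratic {f : ℝ → ℝ} (hf : IsLocalMax f 0) (a₀ a₁ c₀ c₁ c₂ : ℝ)
    (h : ∀ t, f t = (a₀ + a₁ * t) * (c₀ + c₁ * t + c₂ * t ^ 2)) : a₀ * c₁ + a₁ * c₀ = 0 := by
  obtain rfl : f = fun t => (a₀ + a₁ * t) * (c₀ + c₁ * t + c₂ * t ^ 2) := funext h
  have h₁ : HasDerivAt (fun t : ℝ => a₀ + a₁ * t) a₁ 0 := by
    simpa using ((hasDerivAt_id (0 : ℝ)).const_mul a₁).const_add a₀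
  have h₂ : HasDerivAt (fun t : ℝ => c₀ + c₁ * t + c₂ * t ^ 2) c₁ 0 := by
    simpa using (((hasDerivAt_id (0 : ℝ)).const_mul c₁).const_add c₀).fun_add
      (((hasDerivAt_id (0 : ℝ)).pow 2).const_mul c₂)
  have h₃ := hf.hasDerivAt_eq_zero (h₁.mul h₂)
  linarith

/-- The bilinear form of a symmetric matrix is symmetric. -/
theorem Matrix.IsSymm.dotProduct_mulVec_comm {n R : Type*} [Fintype n] [CommSemiring R]
    {S : Matrix n n R} (hS : S.IsSymm) (u v : n → R) : u ⬝ᵥ (S *ᵥ v) = v ⬝ᵥ (S *ᵥ u) := by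
  rw [dotProduct_mulVec, ← mulVec_transpose, hS.eq, dotProduct_comm]

/-- A local maximum of a function on a product space restricts to a local maximum along lines. -/
theorem IsLocalMax.comp_line {E : Type*} [AddCommGroup E] [Module ℝ E] [TopologicalSpace E]
    [ContinuousAdd E] [ContinuousSMul ℝ E] {f : E → ℝ} {x : E} (hf : IsLocalMax f x) (v : E) :
    IsLocalMax (fun t : ℝ => f (x + t • v)) 0 := by
  have hc : ContinuousAt (fun t : ℝ => x + t • v) 0 := by fun_prop
  have hx : x + (0 : ℝ) • v = x := by simp
  exact IsLocalMax.comp_continuous (g := fun t : ℝ => x + t • v) (by rwa [hx]) hc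

/-- At a local maximum of the Nash product with `𝟏ᵀb ≠ 1`, both parties have the same surplus. -/
theorem surplus_eq_of_isLocalMax {n : ℕ} {μ : Fin n → ℝ} {S : Matrix (Fin n) (Fin n) ℝ}
    {r πbar Γbar : ℝ} {b : Fin n → ℝ} {rL : ℝ}
    (hmax : IsLocalMax (fun p : (Fin n → ℝ) × ℝ =>
      nashProductV μ S r πbar Γbar p.1 p.2) (b, rL))
    (hb : (1 : Fin n → ℝ) ⬝ᵥ b ≠ 1) :
    profitRateV r b rL - πbar = growthRateV μ S b rL - Γbar := by
  have h := (hmax.comp_line (0, 1)).affine_mul_quadratic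
    (profitRateV r b rL - πbar) ((1 : Fin n → ℝ) ⬝ᵥ b - 1)
    (growthRateV μ S b rL - Γbar) (1 - (1 : Fin n → ℝ) ⬝ᵥ b) 0 fun t => by
      simp only [nashProductV, profitRateV, growthRateV, Prod.fst_add, Prod.snd_add,
        Prod.smul_fst, Prod.smul_snd, smul_zero, add_zero, smul_eq_mul, mul_one,
        sub_dotProduct, smul_dotProduct]
      ring
  refine mul_left_cancel₀ (sub_ne_zero.mpr hb) ?_
  linarith

/-- At a local maximum of the Nash product with positive equal surpluses, the portfolio is the
growth-optimal one for the broker call rate. -/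
theorem mulVec_eq_of_isLocalMax {n : ℕ} {μ : Fin n → ℝ} {S : Matrix (Fin n) (Fin n) ℝ}
    (hS : S.IsSymm) {r πbar Γbar : ℝ} {b : Fin n → ℝ} {rL : ℝ}
    (hmax : IsLocalMax (fun p : (Fin n → ℝ) × ℝ =>
      nashProductV μ S r πbar Γbar p.1 p.2) (b, rL))
    (hπ : πbar < profitRateV r b rL)
    (heq : profitRateV r b rL - πbar = growthRateV μ S b rL - Γbar) :
    S *ᵥ b = μ - r • (1 : Fin n → ℝ) := by
  refine (sub_eq_zero.mp (dotProduct_eq_zero _ fun v => ?_)).symm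
  have h := (hmax.comp_line (v, 0)).affine_mul_quadratic
    (profitRateV r b rL - πbar) ((rL - r) * ((1 : Fin n → ℝ) ⬝ᵥ v))
    (growthRateV μ S b rL - Γbar)
    (μ ⬝ᵥ v - rL * ((1 : Fin n → ℝ) ⬝ᵥ v) - v ⬝ᵥ (S *ᵥ b))
    (-(1 / 2) * (v ⬝ᵥ (S *ᵥ v))) fun t => by
      simp only [nashProductV, profitRateV, growthRateV, Prod.fst_add, Prod.snd_add,
        Prod.smul_fst, Prod.smul_snd, smul_eq_mul,
        sub_dotProduct, smul_dotProduct, add_dotProduct, dotProduct_add, dotProduct_smul,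
        mulVec_add, mulVec_smul, hS.dotProduct_mulVec_comm b v]
      ring
  rw [← heq] at h
  refine mul_left_cancel₀ (sub_pos.mpr hπ).ne' ?_
  rw [sub_dotProduct, sub_dotProduct, smul_dotProduct, dotProduct_comm (S *ᵥ b), smul_eq_mul]
  linarith

/-- Assume `𝟏ᵀΣ⁻¹(μ - r·𝟏) > 1`.  If `(b*, r_L*)` is a local maximum of the Nash product
with `𝟏ᵀb* > 1`, `π(b*, r_L*) > π̄`, and `Γ(b*, r_L*) > Γ̄`, then the negotiated interest
rate is `r_L* = r/2 + (μᵀΣ⁻¹μ - r²·𝟏ᵀΣ⁻¹𝟏 - 2(Γ̄ - π̄)) / (4(𝟏ᵀΣ⁻¹(μ - r·𝟏) - 1))`. -/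
theorem stmt12 {n : ℕ} (hn : 1 ≤ n) (μ : Fin n → ℝ) (S : Matrix (Fin n) (Fin n) ℝ)
    (hS : S.PosDef) (r πbar Γbar : ℝ)
    (hfav : 1 < (1 : Fin n → ℝ) ⬝ᵥ (S⁻¹ *ᵥ (μ - r • (1 : Fin n → ℝ))))
    (bstar : Fin n → ℝ) (rLstar : ℝ)
    (hmax : IsLocalMax (fun p : (Fin n → ℝ) × ℝ =>
      nashProductV μ S r πbar Γbar p.1 p.2) (bstar, rLstar))
    (hb : 1 < (1 : Fin n → ℝ) ⬝ᵥ bstar)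
    (hπ : πbar < profitRateV r bstar rLstar)
    (hΓ : Γbar < growthRateV μ S bstar rLstar) :
    rLstar = r / 2 +
      (μ ⬝ᵥ (S⁻¹ *ᵥ μ) - r ^ 2 * ((1 : Fin n → ℝ) ⬝ᵥ (S⁻¹ *ᵥ (1 : Fin n → ℝ)))
        - 2 * (Γbar - πbar)) /
      (4 * ((1 : Fin n → ℝ) ⬝ᵥ (S⁻¹ *ᵥ (μ - r • (1 : Fin n → ℝ))) - 1)) := by
  have hsymm : S.IsSymm := by simpa [IsSymm, IsHermitian] using hS.isHermitian
  have heq := surplus_eq_of_isLocalMax hmax hb.ne'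
  have hSb := mulVec_eq_of_isLocalMax hsymm hmax hπ heq
  have hbs : S⁻¹ *ᵥ (μ - r • (1 : Fin n → ℝ)) = bstar := by
    rw [← hSb, mulVec_mulVec, nonsing_inv_mul _ ((isUnit_iff_isUnit_det S).mp hS.isUnit),
      one_mulVec]
  have hinv : S⁻¹.IsSymm := by rw [IsSymm, transpose_nonsing_inv, hsymm.eq]
  have hquad : μ ⬝ᵥ (S⁻¹ *ᵥ μ) - r ^ 2 * ((1 : Fin n → ℝ) ⬝ᵥ (S⁻¹ *ᵥ (1 : Fin n → ℝ))) =
      μ ⬝ᵥ bstar + r * ((1 : Fin n → ℝ) ⬝ᵥ bstar) := by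
    simp only [← hbs, mulVec_sub, mulVec_smul, dotProduct_sub, dotProduct_smul, smul_eq_mul,
      hinv.dotProduct_mulVec_comm 1 μ]
    ring
  have hs : (4 : ℝ) * ((1 : Fin n → ℝ) ⬝ᵥ bstar - 1) ≠ 0 :=
    mul_ne_zero four_ne_zero (sub_pos.mpr hb).ne'
  rw [hquad, hbs, ← sub_eq_iff_eq_add', eq_div_iff hs]
  simp only [profitRateV, growthRateV, hSb, sub_dotProduct, smul_dotProduct, smul_eq_mul,
    dotProduct_comm bstar] at heq
  linarith
end

section
/- For all b ∈ ℝⁿ and r_L ∈ ℝ, the identity Γ(b, r_L) + π(b, r_L) = r + (μ - r·𝟏)ᵀb - (1/2)bᵀΣb holds; consequently Γ(b, r_L) + π(b, r_L) ≤ r + (1/2)(μ - r·𝟏)ᵀΣ⁻¹(μ - r·𝟏), with equality if and only if b = Σ⁻¹(μ - r·𝟏). Hence the efficient profit–growth frontier is the straight line Γ = r + (1/2)(μ - r·𝟏)ᵀΣ⁻¹(μ - r·𝟏) - π of slope -1. -/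
open Matrix

theorem growthRateV_add_profitRateV {n : ℕ} (μ : Fin n → ℝ) (S : Matrix (Fin n) (Fin n) ℝ)
    (r : ℝ) (b : Fin n → ℝ) (rL : ℝ) :
    growthRateV μ S b rL + profitRateV r b rL =
      r + (μ - r • (1 : Fin n → ℝ)) ⬝ᵥ b - (1 / 2) * (b ⬝ᵥ (S *ᵥ b)) := by
  simp only [growthRateV, profitRateV, sub_dotProduct, smul_dotProduct, smul_eq_mul]
  ring

/-- Completing the square for the concave quadratic `b ↦ vᵀb - (1/2)bᵀSb`. -/
theorem Matrix.PosDef.dotProduct_sub_half_quadratic {n : ℕ} {S : Matrix (Fin n) (Fin n) ℝ}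
    (hS : S.PosDef) (v b : Fin n → ℝ) :
    v ⬝ᵥ b - (1 / 2) * (b ⬝ᵥ (S *ᵥ b)) =
      (1 / 2) * (v ⬝ᵥ (S⁻¹ *ᵥ v)) -
        (1 / 2) * ((b - S⁻¹ *ᵥ v) ⬝ᵥ (S *ᵥ (b - S⁻¹ *ᵥ v))) := by
  have hv : S *ᵥ (S⁻¹ *ᵥ v) = v := by
    rw [mulVec_mulVec, mul_nonsing_inv S ((isUnit_iff_isUnit_det S).mp hS.isUnit), one_mulVec]
  have hT : Sᵀ = S := by simpa using hS.isHermitian.eq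
  have hsymm : (S⁻¹ *ᵥ v) ⬝ᵥ (S *ᵥ b) = v ⬝ᵥ b := by
    rw [dotProduct_mulVec, ← mulVec_transpose, hT, hv]
  simp only [mulVec_sub, dotProduct_sub, sub_dotProduct, hv, hsymm]
  rw [dotProduct_comm b v, dotProduct_comm (S⁻¹ *ᵥ v) v]
  ring

/-- For all `b ∈ ℝⁿ` and `r_L ∈ ℝ`: the identity
`Γ(b,r_L) + π(b,r_L) = r + (μ - r·𝟏)ᵀb - (1/2)bᵀΣb` holds; hence
`Γ + π ≤ r + (1/2)(μ - r·𝟏)ᵀΣ⁻¹(μ - r·𝟏)`, with equality iff `b = Σ⁻¹(μ - r·𝟏)`.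
Hence the efficient profit–growth frontier is the straight line
`Γ = r + (1/2)(μ - r·𝟏)ᵀΣ⁻¹(μ - r·𝟏) - π` of slope `-1`. -/
theorem stmt13 {n : ℕ} (hn : 1 ≤ n) (μ : Fin n → ℝ) (S : Matrix (Fin n) (Fin n) ℝ)
    (hS : S.PosDef) (r : ℝ) :
    ∀ (b : Fin n → ℝ) (rL : ℝ),
      (growthRateV μ S b rL + profitRateV r b rL =
        r + (μ - r • (1 : Fin n → ℝ)) ⬝ᵥ b - (1 / 2) * (b ⬝ᵥ (S *ᵥ b))) ∧
      growthRateV μ S b rL + profitRateV r b rL ≤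
        r + (1 / 2) * ((μ - r • (1 : Fin n → ℝ)) ⬝ᵥ (S⁻¹ *ᵥ (μ - r • (1 : Fin n → ℝ)))) ∧
      (growthRateV μ S b rL + profitRateV r b rL =
          r + (1 / 2) * ((μ - r • (1 : Fin n → ℝ)) ⬝ᵥ (S⁻¹ *ᵥ (μ - r • (1 : Fin n → ℝ)))) ↔
        b = S⁻¹ *ᵥ (μ - r • (1 : Fin n → ℝ))) := by
  intro b rL
  have hsum := growthRateV_add_profitRateV μ S r b rL
  have hsq := hS.dotProduct_sub_half_quadratic (μ - r • (1 : Fin n → ℝ)) b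
  refine ⟨hsum, ?_, fun h => ?_, fun h => ?_⟩
  · have hnonneg := hS.posSemidef.dotProduct_mulVec_nonneg
      (b - S⁻¹ *ᵥ (μ - r • (1 : Fin n → ℝ)))
    rw [star_trivial] at hnonneg
    linarith
  · by_contra hne
    have hpos := (posDef_iff_dotProduct_mulVec.mp hS).2 (sub_ne_zero.mpr hne)
    rw [star_trivial] at hpos
    linarith
  · rw [sub_eq_zero.mpr h, zero_dotProduct] at hsq
    linarith
end

section
/- Fix a risk-aversion coefficient γ > 0. Suppose (b*, r_L*) is a local maximum of the Nash product N_γ(b, r_L) := (π(b, r_L) - π̄)(Γ_γ(b, r_L) - Γ̄) with 𝟏ᵀb* > 1, π(b*, r_L*) > π̄, and Γ_γ(b*, r_L*) > Γ̄. Then b* = (1/γ)·Σ⁻¹(μ - r·𝟏), and if additionally 𝟏ᵀΣ⁻¹(μ - r·𝟏) > γ, then r_L* = r/2 + (μᵀΣ⁻¹μ - r²·𝟏ᵀΣ⁻¹𝟏 - 2γ(Γ̄ - π̄)) / (4(𝟏ᵀΣ⁻¹(μ - r·𝟏) - γ)). -/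
open Matrix

/-- The CRRA investor's growth rate `Γ_γ(b, r_L) = r_L + (μ - r_L·𝟏)ᵀb - (γ/2)bᵀΣb`. -/
noncomputable def growthRateCRRA {n : ℕ} (μ : Fin n → ℝ) (S : Matrix (Fin n) (Fin n) ℝ)
    (γ : ℝ) (b : Fin n → ℝ) (rL : ℝ) : ℝ :=
  rL + (μ - rL • (1 : Fin n → ℝ)) ⬝ᵥ b - (γ / 2) * (b ⬝ᵥ (S *ᵥ b))

/-- The Nash product `N_γ(b, r_L) = (π(b, r_L) - π̄)(Γ_γ(b, r_L) - Γ̄)`. -/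
noncomputable def nashProductCRRA {n : ℕ} (μ : Fin n → ℝ) (S : Matrix (Fin n) (Fin n) ℝ)
    (γ r πbar Γbar : ℝ) (b : Fin n → ℝ) (rL : ℝ) : ℝ :=
  (profitRateV r b rL - πbar) * (growthRateCRRA μ S γ b rL - Γbar)

/-- First-order condition for a product of two polynomials with a local maximum at `0`. -/
theorem first_order_of_isLocalMax_mul {x a y c d : ℝ}
    (h : IsLocalMax (fun t : ℝ => (x + a * t) * (y + c * t + d * t ^ 2)) 0) :
    a * y + x * c = 0 := by
  have h1 : HasDerivAt (fun t : ℝ => x + a * t) a 0 := by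
    simpa using ((hasDerivAt_id (0 : ℝ)).const_mul a).const_add x
  have h2 : HasDerivAt (fun t : ℝ => y + c * t + d * t ^ 2) c 0 := by
    simpa using (((hasDerivAt_id (0 : ℝ)).const_mul c).const_add y).fun_add
      ((hasDerivAt_pow 2 (0 : ℝ)).const_mul d)
  simpa using h.hasDerivAt_eq_zero (h1.fun_mul h2)

theorem profitRateV_add_smul {n : ℕ} (r : ℝ) (b v : Fin n → ℝ) (rL t : ℝ) :
    profitRateV r (b + t • v) rL
      = profitRateV r b rL + ((1 : Fin n → ℝ) ⬝ᵥ v * (rL - r)) * t := by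
  simp only [profitRateV, dotProduct_add, dotProduct_smul, smul_eq_mul]
  ring

theorem growthRateCRRA_add_smul {n : ℕ} (μ : Fin n → ℝ) {S : Matrix (Fin n) (Fin n) ℝ}
    (hS : S.IsSymm) (γ : ℝ) (b v : Fin n → ℝ) (rL t : ℝ) :
    growthRateCRRA μ S γ (b + t • v) rL
      = growthRateCRRA μ S γ b rL
        + ((μ - rL • (1 : Fin n → ℝ)) ⬝ᵥ v - γ * (v ⬝ᵥ (S *ᵥ b))) * t
        + (-(γ / 2) * (v ⬝ᵥ (S *ᵥ v))) * t ^ 2 := by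
  have hsymm : b ⬝ᵥ (S *ᵥ v) = v ⬝ᵥ (S *ᵥ b) := by
    rw [dotProduct_mulVec, ← mulVec_transpose, hS.eq, dotProduct_comm]
  simp only [growthRateCRRA, mulVec_add, mulVec_smul, dotProduct_add, add_dotProduct,
    dotProduct_smul, smul_dotProduct, smul_eq_mul, hsymm]
  ring

/-- Fix `γ > 0`.  If `(b*, r_L*)` is a local maximum of the Nash product `N_γ` with
`𝟏ᵀb* > 1`, `π(b*, r_L*) > π̄`, and `Γ_γ(b*, r_L*) > Γ̄`, then
`b* = (1/γ)·Σ⁻¹(μ - r·𝟏)`, and if additionally `𝟏ᵀΣ⁻¹(μ - r·𝟏) > γ` then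
`r_L* = r/2 + (μᵀΣ⁻¹μ - r²·𝟏ᵀΣ⁻¹𝟏 - 2γ(Γ̄ - π̄)) / (4(𝟏ᵀΣ⁻¹(μ - r·𝟏) - γ))`. -/
theorem stmt16 {n : ℕ} (hn : 1 ≤ n) (μ : Fin n → ℝ) (S : Matrix (Fin n) (Fin n) ℝ)
    (hS : S.PosDef) (r γ πbar Γbar : ℝ) (hγ : 0 < γ)
    (bstar : Fin n → ℝ) (rLstar : ℝ)
    (hmax : IsLocalMax (fun p : (Fin n → ℝ) × ℝ =>
      nashProductCRRA μ S γ r πbar Γbar p.1 p.2) (bstar, rLstar))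
    (hb : 1 < (1 : Fin n → ℝ) ⬝ᵥ bstar)
    (hπ : πbar < profitRateV r bstar rLstar)
    (hΓ : Γbar < growthRateCRRA μ S γ bstar rLstar) :
    bstar = (1 / γ) • (S⁻¹ *ᵥ (μ - r • (1 : Fin n → ℝ))) ∧
    (γ < (1 : Fin n → ℝ) ⬝ᵥ (S⁻¹ *ᵥ (μ - r • (1 : Fin n → ℝ))) →
      rLstar = r / 2 +
        (μ ⬝ᵥ (S⁻¹ *ᵥ μ) - r ^ 2 * ((1 : Fin n → ℝ) ⬝ᵥ (S⁻¹ *ᵥ (1 : Fin n → ℝ)))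
          - 2 * γ * (Γbar - πbar)) /
        (4 * ((1 : Fin n → ℝ) ⬝ᵥ (S⁻¹ *ᵥ (μ - r • (1 : Fin n → ℝ))) - γ))) := by
  have hsymm : S.IsSymm := by simpa [IsHermitian, IsSymm] using hS.isHermitian
  have hdet : IsUnit S.det := hS.det_pos.ne'.isUnit
  have hrate : profitRateV r bstar rLstar - πbar
      = growthRateCRRA μ S γ bstar rLstar - Γbar := by
    have hline : IsLocalMax (fun t : ℝ =>
        nashProductCRRA μ S γ r πbar Γbar bstar (rLstar + t)) 0 := by
      have hcont : Continuous (fun t : ℝ => (bstar, rLstar + t)) := by fun_prop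
      refine IsLocalMax.comp_continuous (g := fun t : ℝ => (bstar, rLstar + t)) (b := 0)
        (by simpa using hmax) hcont.continuousAt
    have hfun : (fun t : ℝ => nashProductCRRA μ S γ r πbar Γbar bstar (rLstar + t))
        = fun t : ℝ =>
          (profitRateV r bstar rLstar - πbar + ((1 : Fin n → ℝ) ⬝ᵥ bstar - 1) * t)
          * (growthRateCRRA μ S γ bstar rLstar - Γbar
            + (1 - (1 : Fin n → ℝ) ⬝ᵥ bstar) * t + 0 * t ^ 2) := by
      funext t
      simp only [nashProductCRRA, profitRateV, growthRateCRRA, sub_dotProduct, smul_dotProduct,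
        smul_eq_mul]
      ring
    have hfoc := first_order_of_isLocalMax_mul (hfun ▸ hline)
    have hne : (1 : Fin n → ℝ) ⬝ᵥ bstar - 1 ≠ 0 := (sub_pos.mpr hb).ne'
    apply mul_left_cancel₀ hne
    linear_combination -hfoc
  have hgrad (v : Fin n → ℝ) :
      v ⬝ᵥ (μ - r • (1 : Fin n → ℝ)) = v ⬝ᵥ (γ • (S *ᵥ bstar)) := by
    have hline : IsLocalMax (fun t : ℝ =>
        nashProductCRRA μ S γ r πbar Γbar (bstar + t • v) rLstar) 0 := by
      have hcont : Continuous (fun t : ℝ => (bstar + t • v, rLstar)) := by fun_prop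
      refine IsLocalMax.comp_continuous (g := fun t : ℝ => (bstar + t • v, rLstar)) (b := 0)
        (by simpa using hmax) hcont.continuousAt
    have hfun : (fun t : ℝ => nashProductCRRA μ S γ r πbar Γbar (bstar + t • v) rLstar)
        = fun t : ℝ =>
          (profitRateV r bstar rLstar - πbar + ((1 : Fin n → ℝ) ⬝ᵥ v * (rLstar - r)) * t)
          * (growthRateCRRA μ S γ bstar rLstar - Γbar
            + ((μ - rLstar • (1 : Fin n → ℝ)) ⬝ᵥ v - γ * (v ⬝ᵥ (S *ᵥ bstar))) * t
            + (-(γ / 2) * (v ⬝ᵥ (S *ᵥ v))) * t ^ 2) := by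
      funext t
      rw [nashProductCRRA, profitRateV_add_smul, growthRateCRRA_add_smul μ hsymm]
      ring
    have hfoc := first_order_of_isLocalMax_mul (hfun ▸ hline)
    rw [← hrate] at hfoc
    apply mul_left_cancel₀ (sub_pos.mpr hπ).ne'
    simp only [sub_dotProduct, smul_dotProduct, dotProduct_sub, dotProduct_smul, smul_eq_mul,
      dotProduct_comm v μ, dotProduct_comm v 1] at hfoc ⊢
    linear_combination hfoc
  have hSb : μ - r • (1 : Fin n → ℝ) = γ • (S *ᵥ bstar) := dotProduct_eq _ _ fun v => by
    simpa only [dotProduct_comm] using hgrad v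
  have hbstar : bstar = (1 / γ) • (S⁻¹ *ᵥ (μ - r • (1 : Fin n → ℝ))) := by
    rw [hSb, mulVec_smul, mulVec_mulVec, nonsing_inv_mul _ hdet, one_mulVec, smul_smul,
      one_div_mul_cancel hγ.ne', one_smul]
  refine ⟨hbstar, fun _ => ?_⟩
  have hinv : S⁻¹ *ᵥ (μ - r • (1 : Fin n → ℝ)) = γ • bstar := by
    rw [hbstar, smul_smul, mul_one_div_cancel hγ.ne', one_smul]
  have hquad : μ ⬝ᵥ (S⁻¹ *ᵥ μ) - r ^ 2 * ((1 : Fin n → ℝ) ⬝ᵥ (S⁻¹ *ᵥ (1 : Fin n → ℝ)))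
      = γ * (μ ⬝ᵥ bstar + r * ((1 : Fin n → ℝ) ⬝ᵥ bstar)) := by
    have hcross : (1 : Fin n → ℝ) ⬝ᵥ (S⁻¹ *ᵥ μ) = μ ⬝ᵥ (S⁻¹ *ᵥ (1 : Fin n → ℝ)) := by
      rw [dotProduct_mulVec, ← mulVec_transpose, transpose_nonsing_inv, hsymm.eq,
        dotProduct_comm]
    have hμ := congrArg (μ ⬝ᵥ ·) hinv
    have hone := congrArg ((1 : Fin n → ℝ) ⬝ᵥ ·) hinv
    simp only [mulVec_sub, mulVec_smul, dotProduct_sub, dotProduct_smul, smul_eq_mul]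
      at hμ hone
    linear_combination hμ + r * hone - r * hcross
  have hvar := hgrad bstar
  simp only [dotProduct_sub, dotProduct_smul, smul_eq_mul, dotProduct_comm bstar μ,
    dotProduct_comm bstar 1] at hvar
  simp only [profitRateV, growthRateCRRA, sub_dotProduct, smul_dotProduct, smul_eq_mul] at hrate
  rw [hinv, hquad, dotProduct_smul, smul_eq_mul]
  have hden : 4 * (γ * ((1 : Fin n → ℝ) ⬝ᵥ bstar) - γ) ≠ 0 := by
    have := mul_pos hγ (sub_pos.mpr hb)
    nlinarith
  rw [← sub_eq_iff_eq_add', eq_div_iff hden]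
  linear_combination 2 * γ * hrate + γ * hvar
end

section
/- Fix γ > 0. For all b ∈ ℝⁿ and r_L ∈ ℝ, the identity Γ_γ(b, r_L) + π(b, r_L) = r + (μ - r·𝟏)ᵀb - (γ/2)bᵀΣb holds; consequently Γ_γ(b, r_L) + π(b, r_L) ≤ r + (1/(2γ))(μ - r·𝟏)ᵀΣ⁻¹(μ - r·𝟏), with equality if and only if b = (1/γ)·Σ⁻¹(μ - r·𝟏). Hence the efficient frontier for a CRRA investor is the straight line Γ = r + (1/(2γ))(μ - r·𝟏)ᵀΣ⁻¹(μ - r·𝟏) - π, so transferable utility is preserved for general CRRA investors. -/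
open Matrix

/-- Completing the square: the mean-variance objective `vᵀb - (γ/2)bᵀSb` equals its maximum minus
a quadratic form centred at the maximizer `(1/γ)S⁻¹v`. -/
theorem Matrix.PosDef.dotProduct_sub_mul_dotProduct_mulVec {n : ℕ}
    {S : Matrix (Fin n) (Fin n) ℝ} (hS : S.PosDef) {γ : ℝ} (hγ : γ ≠ 0) (v b : Fin n → ℝ) :
    v ⬝ᵥ b - (γ / 2) * (b ⬝ᵥ (S *ᵥ b)) =
      (1 / (2 * γ)) * (v ⬝ᵥ (S⁻¹ *ᵥ v)) -
        (γ / 2) * ((b - (1 / γ) • (S⁻¹ *ᵥ v)) ⬝ᵥ (S *ᵥ (b - (1 / γ) • (S⁻¹ *ᵥ v)))) := by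
  have hSv : S *ᵥ (S⁻¹ *ᵥ v) = v := by
    rw [mulVec_mulVec, mul_nonsing_inv _ ((isUnit_iff_isUnit_det _).1 hS.isUnit), one_mulVec]
  have hST : Sᵀ = S := by simpa [IsHermitian] using hS.isHermitian
  have hcross : (S⁻¹ *ᵥ v) ⬝ᵥ (S *ᵥ b) = v ⬝ᵥ b := by
    rw [dotProduct_mulVec, ← mulVec_transpose, hST, hSv]
  simp only [mulVec_sub, mulVec_smul, hSv, sub_dotProduct, dotProduct_sub, smul_dotProduct,
    dotProduct_smul, hcross, smul_eq_mul, dotProduct_comm b v, dotProduct_comm (S⁻¹ *ᵥ v) v]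
  field_simp
  ring

/-- Fix `γ > 0`.  For all `b ∈ ℝⁿ` and `r_L ∈ ℝ`: the identity
`Γ_γ(b,r_L) + π(b,r_L) = r + (μ - r·𝟏)ᵀb - (γ/2)bᵀΣb` holds; consequently
`Γ_γ + π ≤ r + (1/(2γ))(μ - r·𝟏)ᵀΣ⁻¹(μ - r·𝟏)`, with equality iff
`b = (1/γ)·Σ⁻¹(μ - r·𝟏)`.  Hence the efficient frontier for a CRRA investor is the straight
line `Γ = r + (1/(2γ))(μ - r·𝟏)ᵀΣ⁻¹(μ - r·𝟏) - π`, so transferable utility is preserved. -/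
theorem stmt17 {n : ℕ} (hn : 1 ≤ n) (μ : Fin n → ℝ) (S : Matrix (Fin n) (Fin n) ℝ)
    (hS : S.PosDef) (r γ : ℝ) (hγ : 0 < γ) :
    ∀ (b : Fin n → ℝ) (rL : ℝ),
      (growthRateCRRA μ S γ b rL + profitRateV r b rL =
        r + (μ - r • (1 : Fin n → ℝ)) ⬝ᵥ b - (γ / 2) * (b ⬝ᵥ (S *ᵥ b))) ∧
      growthRateCRRA μ S γ b rL + profitRateV r b rL ≤
        r + (1 / (2 * γ)) * ((μ - r • (1 : Fin n → ℝ)) ⬝ᵥ (S⁻¹ *ᵥ (μ - r • (1 : Fin n → ℝ)))) ∧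
      (growthRateCRRA μ S γ b rL + profitRateV r b rL =
          r + (1 / (2 * γ)) *
            ((μ - r • (1 : Fin n → ℝ)) ⬝ᵥ (S⁻¹ *ᵥ (μ - r • (1 : Fin n → ℝ)))) ↔
        b = (1 / γ) • (S⁻¹ *ᵥ (μ - r • (1 : Fin n → ℝ)))) := by
  intro b rL
  have hsum : growthRateCRRA μ S γ b rL + profitRateV r b rL =
      r + (μ - r • (1 : Fin n → ℝ)) ⬝ᵥ b - (γ / 2) * (b ⬝ᵥ (S *ᵥ b)) := by
    simp only [growthRateCRRA, profitRateV, sub_dotProduct, smul_dotProduct, smul_eq_mul]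
    ring
  refine ⟨hsum, ?_⟩
  rw [hsum, add_sub_assoc, hS.dotProduct_sub_mul_dotProduct_mulVec hγ.ne']
  set d := b - (1 / γ) • (S⁻¹ *ᵥ (μ - r • (1 : Fin n → ℝ))) with hd
  have hnonneg : 0 ≤ d ⬝ᵥ (S *ᵥ d) := by
    simpa using hS.posSemidef.dotProduct_mulVec_nonneg d
  have hzero : d ⬝ᵥ (S *ᵥ d) = 0 ↔ d = 0 := by
    refine ⟨fun h => ?_, fun h => by simp [h]⟩
    by_contra hne
    have hpos : 0 < d ⬝ᵥ (S *ᵥ d) := by simpa using hS.dotProduct_mulVec_pos hne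
    exact hpos.ne' h
  constructor
  · have := mul_nonneg (half_pos hγ).le hnonneg
    linarith
  · rw [add_right_inj, sub_eq_self, mul_eq_zero_iff_left (half_pos hγ).ne', hzero, hd, sub_eq_zero]
end

section
/- Assume μ - σ² > r and take the monopoly threat point π̄ = ((μ - σ² - r)/(2σ))², Γ̄ = (μ - σ² + r)/2 + (1/8)((μ + σ² - r)/σ)². If (b*, r_L*) is a local maximum of the Nash product N with b* > 1, π(b*, r_L*) > π̄, and Γ(b*, r_L*) > Γ̄, then the surplus gained by each party equals half the monopoly deadweight loss: Γ(b*, r_L*) - Γ̄ = π(b*, r_L*) - π̄ = (1/16)((μ - σ² - r)/σ)². -/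
/-- First-order condition of the Nash product in the bet fraction. -/
theorem nashProduct_foc_bet {μ σ r πbar Γbar b rL : ℝ}
    (hmax : IsLocalMax (fun p : ℝ × ℝ => nashProduct μ σ r πbar Γbar p.1 p.2) (b, rL)) :
    (rL - r) * (growthRate μ σ b rL - Γbar)
      + (profitRate r b rL - πbar) * (μ - rL - σ ^ 2 * b) = 0 := by
  have hloc : IsLocalMax (fun x => nashProduct μ σ r πbar Γbar x rL) b :=
    hmax.comp_continuous (g := fun x : ℝ => (x, rL)) (b := b) (by fun_prop)
  have hπ : HasDerivAt (fun x => profitRate r x rL - πbar) (rL - r) b := by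
    simpa [profitRate] using
      (((hasDerivAt_id b).sub_const 1).mul_const (rL - r)).sub_const πbar
  have hΓ : HasDerivAt (fun x => growthRate μ σ x rL - Γbar) (μ - rL - σ ^ 2 * b) b := by
    unfold growthRate
    refine (((((hasDerivAt_id b).mul_const (μ - rL)).const_add rL).sub
      ((hasDerivAt_pow 2 b).const_mul (σ ^ 2 / 2))).sub_const Γbar).congr_deriv ?_
    norm_num
    ring
  exact hloc.hasDerivAt_eq_zero (hπ.mul hΓ)

/-- First-order condition of the Nash product in the margin rate. -/
theorem nashProduct_foc_rate {μ σ r πbar Γbar b rL : ℝ}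
    (hmax : IsLocalMax (fun p : ℝ × ℝ => nashProduct μ σ r πbar Γbar p.1 p.2) (b, rL)) :
    (b - 1) * (growthRate μ σ b rL - Γbar)
      + (profitRate r b rL - πbar) * (1 - b) = 0 := by
  have hloc : IsLocalMax (fun y => nashProduct μ σ r πbar Γbar b y) rL :=
    hmax.comp_continuous (g := fun y : ℝ => (b, y)) (b := rL) (by fun_prop)
  have hπ : HasDerivAt (fun y => profitRate r b y - πbar) (b - 1) rL := by
    simpa [profitRate] using
      (((hasDerivAt_id rL).sub_const r).const_mul (b - 1)).sub_const πbar
  have hΓ : HasDerivAt (fun y => growthRate μ σ b y - Γbar) (1 - b) rL := by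
    unfold growthRate
    refine ((((hasDerivAt_id rL).add (((hasDerivAt_id rL).const_sub μ).const_mul b)).sub_const
      (σ ^ 2 / 2 * b ^ 2)).sub_const Γbar).congr_deriv ?_
    ring
  exact hloc.hasDerivAt_eq_zero (hπ.mul hΓ)

/-- Assume `μ - σ² > r` and take the monopoly threat point `π̄ = ((μ - σ² - r)/(2σ))²`,
`Γ̄ = (μ - σ² + r)/2 + (1/8)((μ + σ² - r)/σ)²`.  If `(b*, r_L*)` is a local maximum of the
Nash product `N` with `b* > 1`, `π(b*, r_L*) > π̄`, and `Γ(b*, r_L*) > Γ̄`, then the surplus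
gained by each party equals half the monopoly deadweight loss:
`Γ(b*, r_L*) - Γ̄ = π(b*, r_L*) - π̄ = (1/16)((μ - σ² - r)/σ)²`. -/
theorem stmt19 (μ σ r : ℝ) (hσ : 0 < σ) (hfav : r < μ - σ ^ 2)
    (πbar Γbar : ℝ)
    (hπbar : πbar = ((μ - σ ^ 2 - r) / (2 * σ)) ^ 2)
    (hΓbar : Γbar = (μ - σ ^ 2 + r) / 2 + (1 / 8) * ((μ + σ ^ 2 - r) / σ) ^ 2)
    (bstar rLstar : ℝ)
    (hmax : IsLocalMax (fun p : ℝ × ℝ => nashProduct μ σ r πbar Γbar p.1 p.2) (bstar, rLstar))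
    (hb : 1 < bstar) (hπ : πbar < profitRate r bstar rLstar)
    (hΓ : Γbar < growthRate μ σ bstar rLstar) :
    growthRate μ σ bstar rLstar - Γbar = (1 / 16) * ((μ - σ ^ 2 - r) / σ) ^ 2 ∧
    profitRate r bstar rLstar - πbar = (1 / 16) * ((μ - σ ^ 2 - r) / σ) ^ 2 := by
  have hσ0 : σ ≠ 0 := hσ.ne'
  have heq : growthRate μ σ bstar rLstar - Γbar = profitRate r bstar rLstar - πbar :=
    mul_left_cancel₀ (sub_pos.2 hb).ne' (by linear_combination nashProduct_foc_rate hmax)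
  have hbet : μ - r - σ ^ 2 * bstar = 0 := by
    have hfoc := nashProduct_foc_bet hmax
    rw [heq] at hfoc
    exact mul_left_cancel₀ (sub_pos.2 hπ).ne' (by linear_combination hfoc)
  have hμ : μ = r + σ ^ 2 * bstar := by linarith
  have hsum := growthRate_add_profitRate μ σ r bstar rLstar
  have htotal : r + bstar * (μ - r) - σ ^ 2 / 2 * bstar ^ 2 - Γbar - πbar
      = (1 / 8) * ((μ - σ ^ 2 - r) / σ) ^ 2 := by
    rw [hΓbar, hπbar, hμ]
    field_simp
    ring
  constructor <;> linarith
end
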